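/- For d ≥ 1 and positive integers l_1, ..., l_d, the sum of all cyclic rotations x_{l_{i+1}} ⋯ x_{l_d} x_{l_1} ⋯ x_{l_i} for i = 0, ..., d-1 is congruent, modulo the Q-subspace of X spanned by all block shuffle products u ⋄ v with u, v nonconstant, to x_{l_1 + ⋯ + l_d} if d is odd and to 0 if d is even. -/

import Mathlib

noncomputable section
namespace BlockShuffle

/-- The underlying vector space of `𝔛 = ℚ⟨x₁, x₂, …⟩`, with words as basis. -/
abbrev XX : Type := List ℕ →₀ ℚ

/-- The basis word `x_{a₁} ⋯ x_{a_d}`. -/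
def wX (w : List ℕ) : XX := Finsupp.single w 1

/-- Left multiplication by the generator `x_a`. -/
def consX (a : ℕ) : XX →ₗ[ℚ] XX := Finsupp.lmapDomain ℚ ℚ (List.cons a)

/-- Left multiplication by the word `x_{a₁} ⋯ x_{a_d}`. -/
def consListX (w : List ℕ) : XX →ₗ[ℚ] XX := Finsupp.lmapDomain ℚ ℚ (w ++ ·)

/-- The shift operator `s_k` with `s_k(x_i w) = x_{i+k} w`, `s_k(1) = 0`. -/
def shiftX (k : ℕ) : XX →ₗ[ℚ] XX :=
  Finsupp.lsum ℚ fun w => LinearMap.toSpanSingleton ℚ XX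
    (match w with
     | [] => 0
     | i :: t => Finsupp.single ((i + k) :: t) (1 : ℚ))

/-- The block shuffle product `⋄` on basis words. -/
def dshW : List ℕ → List ℕ → XX
  | [], v => wX v
  | u, [] => wX u
  | a :: u, b :: v =>
      consX a (dshW u (b :: v)) + consX b (dshW (a :: u) v) - shiftX (a + b) (dshW u v)
  termination_by u v => u.length + v.length

/-- The block shuffle product `⋄ : 𝔛 × 𝔛 → 𝔛`, as a bilinear map. -/
def dshL : XX →ₗ[ℚ] XX →ₗ[ℚ] XX :=
  Finsupp.lsum ℚ fun u => LinearMap.toSpanSingleton ℚ (XX →ₗ[ℚ] XX)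
    (Finsupp.lsum ℚ fun v => LinearMap.toSpanSingleton ℚ XX (dshW u v))

/-- The maps `f_c` on basis words. -/
def fW : ℕ → List ℕ → List ℕ → XX
  | c, [], v => wX (c :: v)
  | c, u, [] => wX (c :: u)
  | c, a :: u, b :: v =>
      consX c (fW a u (b :: v)) + consX c (fW b (a :: u) v) - fW (c + a + b) u v
  termination_by _ u v => u.length + v.length

/-- The bilinear maps `f_c : 𝔛 × 𝔛 → 𝔛`. -/
def fL (c : ℕ) : XX →ₗ[ℚ] XX →ₗ[ℚ] XX :=
  Finsupp.lsum ℚ fun u => LinearMap.toSpanSingleton ℚ (XX →ₗ[ℚ] XX)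
    (Finsupp.lsum ℚ fun v => LinearMap.toSpanSingleton ℚ XX (fW c u v))

/-- The anti-automorphism `S` of `𝔛` with `S(x_k) = -x_k`. -/
def SX : XX →ₗ[ℚ] XX :=
  Finsupp.lsum ℚ fun w => LinearMap.toSpanSingleton ℚ XX (((-1 : ℚ) ^ w.length) • wX w.reverse)

/-- The subspace `𝔛⁺ ⋄ 𝔛⁺` spanned by block shuffle products of nonconstant elements. -/
def diamondSpan : Submodule ℚ XX :=
  Submodule.span ℚ
    {x | ∃ u v : List ℕ, u ≠ [] ∧ v ≠ [] ∧ (∀ i ∈ u, 1 ≤ i) ∧ (∀ i ∈ v, 1 ≤ i) ∧ x = dshW u v}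


/-- Closed recursive variant of the maps `f_c`. -/
def gW : ℕ → List ℕ → List ℕ → XX
  | c, [], v => consX c (wX v)
  | c, u, [] => consX c (wX u)
  | c, a :: u, b :: v => consX c (dshW (a :: u) (b :: v)) - gW (c + a + b) u v
  termination_by _ u v => u.length + v.length

theorem consX_wX (a : ℕ) (w : List ℕ) : consX a (wX w) = wX (a :: w) := by
  simp [consX, wX]

theorem shiftX_wX_nil (k : ℕ) : shiftX k (wX []) = 0 := by
  simp [shiftX, wX]

theorem shiftX_consX (k a : ℕ) (x : XX) : shiftX k (consX a x) = consX (a + k) x := by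
  induction x using Finsupp.induction_linear with
  | zero => simp
  | add f g hf hg => simp [hf, hg]
  | single w r => simp [shiftX, consX]

theorem dshW_nil_left (v : List ℕ) : dshW [] v = wX v := by
  simp [dshW]

theorem dshW_nil_right (u : List ℕ) : dshW u [] = wX u := by
  cases u <;> simp [dshW]

theorem dshW_cons (a b : ℕ) (u v : List ℕ) : dshW (a :: u) (b :: v) =
    consX a (dshW u (b :: v)) + consX b (dshW (a :: u) v) - shiftX (a + b) (dshW u v) := by
  rw [dshW]

theorem gW_nil_left (c : ℕ) (v : List ℕ) : gW c [] v = consX c (wX v) := by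
  simp [gW]

theorem gW_nil_right (c : ℕ) (u : List ℕ) : gW c u [] = consX c (wX u) := by
  cases u <;> simp [gW]

theorem gW_cons (c a b : ℕ) (u v : List ℕ) : gW c (a :: u) (b :: v) =
    consX c (dshW (a :: u) (b :: v)) - gW (c + a + b) u v := by
  rw [gW]

theorem shiftX_gW (k : ℕ) (u : List ℕ) : ∀ (c : ℕ) (v : List ℕ),
    shiftX k (gW c u v) = gW (c + k) u v := by
  induction u with
  | nil => intro c v; simp only [gW_nil_left, shiftX_consX]
  | cons a u ih =>
    intro c v
    cases v with
    | nil => simp only [gW_nil_right, shiftX_consX]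
    | cons b v =>
      simp only [gW_cons, map_sub, shiftX_consX, ih]
      congr 2
      omega

/-- First-letter decomposition of the block shuffle product. -/
theorem dshW_eq_gW (u : List ℕ) : ∀ (a b : ℕ) (v : List ℕ),
    dshW (a :: u) (b :: v) = gW a u (b :: v) + gW b (a :: u) v := by
  induction u with
  | nil =>
    intro a b v
    cases v with
    | nil =>
      simp [dshW_cons, dshW_nil_left, dshW_nil_right, gW_nil_left, gW_nil_right, shiftX_wX_nil]
    | cons b' v =>
      rw [dshW_cons, gW_cons, gW_nil_left, gW_nil_left, dshW_nil_left, dshW_nil_left,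
        ← consX_wX b' v, shiftX_consX]
      rw [show b' + (a + b) = b + a + b' by omega]
      abel
  | cons a' u ih =>
    intro a b v
    cases v with
    | nil =>
      rw [dshW_cons, gW_cons, gW_nil_right, gW_nil_right, dshW_nil_right, dshW_nil_right,
        ← consX_wX a' u, shiftX_consX]
      rw [show a' + (a + b) = a + a' + b by omega]
      abel
    | cons b' v =>
      rw [dshW_cons, gW_cons, gW_cons, ih a' b' v, map_add, shiftX_gW, shiftX_gW]
      rw [show a' + (a + b) = a + a' + b by omega, show b' + (a + b) = b + a + b' by omega]
      abel

/-- Modulo products, `f_c(u, v)` is a signed word. -/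
theorem gW_mod (v : List ℕ) : ∀ (c : ℕ) (u : List ℕ), 1 ≤ c → (∀ i ∈ u, 1 ≤ i) →
    (∀ i ∈ v, 1 ≤ i) →
    (-1 : ℚ) ^ v.length • gW c u v - wX (v.reverse ++ c :: u) ∈ diamondSpan := by
  induction v with
  | nil =>
    intro c u _ _ _
    simp [gW_nil_right, consX_wX]
  | cons b v ih =>
    intro c u hc hu hv
    have h1 := ih b (c :: u) (hv b (by simp)) (by simpa using ⟨hc, hu⟩)
      (fun i hi => hv i (by simp [hi]))
    have h2 : dshW (c :: u) (b :: v) ∈ diamondSpan :=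
      Submodule.subset_span ⟨c :: u, b :: v, by simp, by simp, by simpa using ⟨hc, hu⟩, hv, rfl⟩
    have h3 := dshW_eq_gW u c b v
    have h4 : gW c u (b :: v) = dshW (c :: u) (b :: v) - gW b (c :: u) v := by
      rw [h3]; abel
    have h5 := diamondSpan.sub_mem h1 (diamondSpan.smul_mem ((-1 : ℚ) ^ v.length) h2)
    convert h5 using 1
    rw [h4]
    simp only [List.reverse_cons, List.append_assoc, List.singleton_append, List.length_cons,
      pow_succ]
    module

/-- Signed sum over deconcatenations `w = p q'` of `H p (reverse q')`. -/
def Sm : (List ℕ → List ℕ → XX) → List ℕ → XX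
  | H, [] => H [] []
  | H, b :: m => (-1 : ℚ) ^ (m.length + 1) • H [] (b :: m).reverse + Sm (fun p q => H (b :: p) q) m

theorem Sm_snoc (a : ℕ) (m : List ℕ) : ∀ H : List ℕ → List ℕ → XX,
    Sm H (m ++ [a]) = H (m ++ [a]) [] - Sm (fun p q => H p (a :: q)) m := by
  induction m with
  | nil => intro H; simp [Sm]; abel
  | cons b m ih =>
    intro H
    simp only [List.cons_append, Sm, ih, List.length_append, List.length_cons, List.length_nil,
      List.reverse_cons, List.reverse_append, List.reverse_nil, List.nil_append, pow_succ]
    module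

theorem Sm_add (m : List ℕ) : ∀ H K : List ℕ → List ℕ → XX,
    Sm (fun p q => H p q + K p q) m = Sm H m + Sm K m := by
  induction m with
  | nil => intro H K; simp [Sm]
  | cons b m ih => intro H K; simp only [Sm, ih]; module

theorem Sm_sub (m : List ℕ) : ∀ H K : List ℕ → List ℕ → XX,
    Sm (fun p q => H p q - K p q) m = Sm H m - Sm K m := by
  induction m with
  | nil => intro H K; simp [Sm]
  | cons b m ih => intro H K; simp only [Sm, ih]; module

theorem Sm_map (f : XX →ₗ[ℚ] XX) (m : List ℕ) : ∀ H : List ℕ → List ℕ → XX,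
    Sm (fun p q => f (H p q)) m = f (Sm H m) := by
  induction m with
  | nil => intro H; simp [Sm]
  | cons b m ih => intro H; simp only [Sm, ih, map_add, map_smul]

theorem Sm_eq_sum (m : List ℕ) : ∀ H : List ℕ → List ℕ → XX,
    Sm H m = ∑ i ∈ Finset.range (m.length + 1),
      (-1 : ℚ) ^ (m.drop i).length • H (m.take i) (m.drop i).reverse := by
  induction m with
  | nil => intro H; simp [Sm]
  | cons b m ih =>
    intro H
    rw [Sm, ih, List.length_cons, Finset.sum_range_succ' _ (m.length + 1), add_comm]
    simp

theorem Sm_both (H : List ℕ → List ℕ → XX) (a b : ℕ) (m : List ℕ) :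
    Sm H (b :: (m ++ [a])) = (-1 : ℚ) ^ m.length • H [] (b :: (m ++ [a])).reverse
      + H (b :: (m ++ [a])) [] - Sm (fun p q => H (b :: p) (a :: q)) m := by
  rw [Sm, Sm_snoc, List.length_append, List.length_singleton, pow_succ, pow_succ]
  module

/-- The antipode identity. -/
theorem Sm_dshW (n : ℕ) : ∀ w : List ℕ, w.length = n → w ≠ [] → Sm dshW w = 0 := by
  induction n using Nat.strong_induction_on with
  | _ n ih =>
  intro w hw hne
  rcases w with _ | ⟨b, w⟩
  · exact absurd rfl hne
  rcases List.eq_nil_or_concat w with rfl | ⟨m, a, rfl⟩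
  · simp [Sm, dshW_nil_left, dshW_nil_right]
  simp only [List.concat_eq_append] at *
  have hl : n = m.length + 2 := by rw [← hw]; simp
  have h1 : Sm dshW (m ++ [a]) = 0 := ih (m.length + 1) (by omega) _ (by simp) (by simp)
  have h2 : Sm dshW (b :: m) = 0 := ih (m.length + 1) (by omega) _ (by simp) (by simp)
  have h3 : shiftX (b + a) (Sm dshW m) = 0 := by
    rcases m with _ | ⟨e, m⟩
    · simp [Sm, dshW_nil_left, shiftX_wX_nil]
    · rw [ih (m.length + 1) (by simp at hl; omega) _ (by simp) (by simp), map_zero]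
  rw [Sm_snoc, sub_eq_zero, dshW_nil_right] at h1
  rw [Sm, dshW_nil_left, add_comm, ← eq_neg_iff_add_eq_zero] at h2
  rw [Sm_both]
  simp only [dshW_cons]
  rw [Sm_sub, Sm_add, Sm_map, Sm_map, Sm_map, h3, ← h1, h2]
  simp only [dshW_nil_left, dshW_nil_right, map_neg, map_smul, consX_wX, List.reverse_cons,
    List.reverse_append, List.reverse_nil, List.nil_append, List.cons_append, pow_succ]
  module

theorem Sm_gW (n : ℕ) : ∀ (w : List ℕ) (c : ℕ), w.length = n →
    Sm (gW c) w = if Even n then wX [c + w.sum] else 0 := by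
  induction n using Nat.strong_induction_on with
  | _ n ih =>
  intro w c hw
  rcases w with _ | ⟨b, w⟩
  · subst hw
    simp [Sm, gW_nil_left, consX_wX]
  rcases List.eq_nil_or_concat w with rfl | ⟨m, a, rfl⟩
  · subst hw
    simp [Sm, gW_nil_left, gW_nil_right]
  simp only [List.concat_eq_append] at *
  have hl : n = m.length + 2 := by rw [← hw]; simp
  have h1 := Sm_dshW n (b :: (m ++ [a])) hw (by simp)
  have h2 := ih m.length (by omega) m (c + b + a) rfl
  rw [Sm_both, dshW_nil_left, dshW_nil_right, sub_eq_zero] at h1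
  rw [Sm_both]
  simp only [gW_cons]
  rw [Sm_sub, Sm_map, ← h1, h2, gW_nil_left, gW_nil_right, map_add, map_smul, hl]
  have h3 : c + b + a + m.sum = c + (b :: (m ++ [a])).sum := by simp; omega
  rw [h3]
  simp only [Nat.even_add, even_two, iff_true]
  abel

theorem cyclic_list (c : ℕ) (m : List ℕ) (hc : 1 ≤ c) (hm : ∀ i ∈ m, 1 ≤ i) :
    (∑ i ∈ Finset.range (m.length + 1), wX ((c :: m).rotate i)) -
      (if Even m.length then wX [c + m.sum] else 0) ∈ diamondSpan := by
  rw [← Sm_gW m.length m c rfl, Sm_eq_sum]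
  have h1 : ∑ i ∈ Finset.range (m.length + 1), wX ((c :: m).rotate i) =
      ∑ i ∈ Finset.range (m.length + 1), wX (m.drop i ++ c :: m.take i) := by
    rw [Finset.sum_range_succ', List.rotate_zero, Finset.sum_range_succ]
    congr 1
    · refine Finset.sum_congr rfl fun i hi => ?_
      rw [Finset.mem_range] at hi
      rw [List.rotate_eq_drop_append_take (by simp; omega)]
      simp
    · simp
  rw [h1, ← neg_mem_iff, neg_sub, ← Finset.sum_sub_distrib]
  refine Submodule.sum_mem _ fun i _ => ?_
  have h2 := gW_mod (m.drop i).reverse c (m.take i) hc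
    (fun j hj => hm j (List.mem_of_mem_take hj))
    (fun j hj => hm j (List.mem_of_mem_drop (List.mem_reverse.1 hj)))
  rwa [List.reverse_reverse, List.length_reverse] at h2

/-- Proposition `cyclic_in_msh`: cyclic sums modulo `𝔛⁺ ⋄ 𝔛⁺`. -/
theorem cyclic_sum_mod_diamondSpan (d : ℕ) (hd : 1 ≤ d) (l : Fin d → ℕ) (hl : ∀ i, 1 ≤ l i) :
    (∑ i ∈ Finset.range d, wX ((List.ofFn l).rotate i)) -
        (if Odd d then wX [∑ i, l i] else 0) ∈ diamondSpan := by
  obtain ⟨k, rfl⟩ : ∃ k, d = k + 1 := ⟨d - 1, by omega⟩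
  have h := cyclic_list (l 0) (List.ofFn fun i : Fin k => l i.succ) (hl 0) (by
    intro i hi
    obtain ⟨j, rfl⟩ := (List.mem_ofFn' _ _).1 hi
    exact hl _)
  rw [List.length_ofFn, ← List.ofFn_succ, List.sum_ofFn, ← Fin.sum_univ_succ] at h
  simpa only [Nat.odd_add_one, Nat.not_odd_iff_even] using h


end BlockShuffle
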